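/- Trace-type estimate for the free von-Neumann Schrödinger flow: for every ε > 0 there is a constant C = C(ε) > 0 such that for every Schwartz Γ₀ on ℝ², the solution Γ(t) = e^{it(Δ_x−Δ_y)}Γ₀ satisfies sup_{t∈ℝ} ‖ |∇_x|^{ε} ρ_Γ(t,·) ‖_{L²(ℝ_x)} ≤ C ‖ |∇_{x,y}|^{1/2+ε} Γ₀ ‖_{L²(ℝ²)}. -/

import Mathlib

open MeasureTheory Complex SchwartzMap
open scoped ENNReal NNReal Real

noncomputable section

/-- 1D Fourier transform with the convention `f̂ ξ = ∫ e^{-iξx} f x dx`. -/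
def FT1 (f : ℝ → ℂ) (ξ : ℝ) : ℂ :=
  ∫ x : ℝ, Complex.exp (-(Complex.I) * (ξ : ℂ) * (x : ℂ)) * f x

/-- 1D inverse Fourier transform. -/
def IFT1 (g : ℝ → ℂ) (x : ℝ) : ℂ :=
  (2 * (Real.pi : ℂ))⁻¹ * ∫ ξ : ℝ, Complex.exp (Complex.I * (ξ : ℂ) * (x : ℂ)) * g ξ

/-- 2D Fourier transform (curried kernels). -/
def FT2 (f : ℝ → ℝ → ℂ) (ξ η : ℝ) : ℂ :=
  ∫ x : ℝ, ∫ y : ℝ, Complex.exp (-(Complex.I) * ((ξ : ℂ) * x + (η : ℂ) * y)) * f x y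

/-- 2D inverse Fourier transform. -/
def IFT2 (g : ℝ → ℝ → ℂ) (x y : ℝ) : ℂ :=
  ((2 * (Real.pi : ℂ)) ^ 2)⁻¹ *
    ∫ ξ : ℝ, ∫ η : ℝ, Complex.exp (Complex.I * ((ξ : ℂ) * x + (η : ℂ) * y)) * g ξ η

/-- Free propagator `e^{it(Δ_x − Δ_y)}`, Fourier multiplier `e^{it(η²−ξ²)}`. -/
def freeGamma (Γ₀ : ℝ → ℝ → ℂ) (t x y : ℝ) : ℂ :=
  IFT2 (fun ξ η => Complex.exp (Complex.I * (t : ℂ) * ((η : ℂ) ^ 2 - (ξ : ℂ) ^ 2)) * FT2 Γ₀ ξ η) x y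

/-- Free propagator `e^{it(Δ_x + Δ_y)}`, Fourier multiplier `e^{−it(ξ²+η²)}`. -/
def freeLambda (Λ₀ : ℝ → ℝ → ℂ) (t x y : ℝ) : ℂ :=
  IFT2 (fun ξ η => Complex.exp (-(Complex.I) * (t : ℂ) * ((ξ : ℂ) ^ 2 + (η : ℂ) ^ 2)) * FT2 Λ₀ ξ η) x y

/-- `|∇_x|^s`, Fourier multiplier `|ξ|^s` in one variable. -/
def absDx (s : ℝ) (f : ℝ → ℂ) (x : ℝ) : ℂ :=
  IFT1 (fun ξ => ((|ξ| ^ s : ℝ) : ℂ) * FT1 f ξ) x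

/-- `|∇_{x,y}|^s`, Fourier multiplier `(ξ²+η²)^{s/2}` on `ℝ²`. -/
def absDxy (s : ℝ) (f : ℝ → ℝ → ℂ) (x y : ℝ) : ℂ :=
  IFT2 (fun ξ η => (((ξ ^ 2 + η ^ 2) ^ (s / 2) : ℝ) : ℂ) * FT2 f ξ η) x y

/-- `|∇_{x+y}|^s`, Fourier multiplier `(|ξ+η|/2)^s` on `ℝ²`. -/
def absDxpy (s : ℝ) (f : ℝ → ℝ → ℂ) (x y : ℝ) : ℂ :=
  IFT2 (fun ξ η => (((|ξ + η| / 2) ^ s : ℝ) : ℂ) * FT2 f ξ η) x y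

/-- `⟨∇_x⟩^s`, Fourier multiplier `(1+ξ²)^{s/2}` in one variable. -/
def japDx (s : ℝ) (f : ℝ → ℂ) (x : ℝ) : ℂ :=
  IFT1 (fun ξ => (((1 + ξ ^ 2) ^ (s / 2) : ℝ) : ℂ) * FT1 f ξ) x

/-- `⟨∇_{x,y}⟩^s`, Fourier multiplier `(1+ξ²+η²)^{s/2}` on `ℝ²`. -/
def japDxy (s : ℝ) (f : ℝ → ℝ → ℂ) (x y : ℝ) : ℂ :=
  IFT2 (fun ξ η => (((1 + ξ ^ 2 + η ^ 2) ^ (s / 2) : ℝ) : ℂ) * FT2 f ξ η) x y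

/-- `L²` norm of a kernel on `ℝ²`. -/
def L2K (f : ℝ → ℝ → ℂ) : ℝ≥0∞ :=
  eLpNorm (fun p : ℝ × ℝ => f p.1 p.2) 2 volume

/-- `L²` norm on `ℝ`. -/
def L2F (f : ℝ → ℂ) : ℝ≥0∞ := eLpNorm f 2 volume

/-- Mixed norm `L^q(μ(dt)) L^r(dx)` for a function of `(t,x)`. -/
def MixedN2 (μ : Measure ℝ) (q r : ℝ≥0∞) (u : ℝ → ℝ → ℂ) : ℝ≥0∞ :=
  eLpNorm (fun t => (eLpNorm (u t) r volume).toReal) q μ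

/-- Mixed norm `L^q(μ(dt)) L^r(dx) L^s(dy)` for a function of `(t,x,y)`. -/
def MixedN3 (μ : Measure ℝ) (q r s : ℝ≥0∞) (u : ℝ → ℝ → ℝ → ℂ) : ℝ≥0∞ :=
  eLpNorm (fun t => (eLpNorm (fun x => (eLpNorm (u t x) s volume).toReal) r volume).toReal) q μ

/-- Spacetime Fourier transform on `ℝ_t × ℝ_x`. -/
def FTtx (u : ℝ → ℝ → ℂ) (τ ξ : ℝ) : ℂ :=
  ∫ t : ℝ, ∫ x : ℝ, Complex.exp (-(Complex.I) * ((τ : ℂ) * t + (ξ : ℂ) * x)) * u t x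

/-- Spacetime Fourier transform on `ℝ_t × ℝ²`. -/
def FTtxy (u : ℝ → ℝ → ℝ → ℂ) (τ ξ η : ℝ) : ℂ :=
  ∫ t : ℝ, ∫ x : ℝ, ∫ y : ℝ,
    Complex.exp (-(Complex.I) * ((τ : ℂ) * t + (ξ : ℂ) * x + (η : ℂ) * y)) * u t x y

/-- Bourgain space norm `X^b` associated to `𝐒 = (1/i)∂_t − Δ_x − Δ_y`. -/
def XbNorm (b : ℝ) (u : ℝ → ℝ → ℝ → ℂ) : ℝ≥0∞ :=
  eLpNorm (fun p : ℝ × ℝ × ℝ =>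
    (((1 + |p.1 + p.2.1 ^ 2 + p.2.2 ^ 2|) ^ b : ℝ) : ℂ) * FTtxy u p.1 p.2.1 p.2.2) 2 volume

/-- Duhamel solution of `𝐒_± Γ = F` with data `Γ₀`. -/
def duhamelGamma (Γ₀ : ℝ → ℝ → ℂ) (F : ℝ → ℝ → ℝ → ℂ) (t x y : ℝ) : ℂ :=
  freeGamma Γ₀ t x y + Complex.I * ∫ s in (0:ℝ)..t, freeGamma (F s) (t - s) x y

/-- Duhamel solution of `𝐒 Λ = F` with data `Λ₀`. -/
def duhamelLambda (Λ₀ : ℝ → ℝ → ℂ) (F : ℝ → ℝ → ℝ → ℂ) (t x y : ℝ) : ℂ :=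
  freeLambda Λ₀ t x y + Complex.I * ∫ s in (0:ℝ)..t, freeLambda (F s) (t - s) x y


open FourierTransform
open scoped ContDiff

theorem hasTemperateGrowth_cexp_I_mul :
    Function.HasTemperateGrowth (fun x : ℝ => cexp (I * x)) := by
  refine ⟨(contDiff_const.mul Complex.ofRealCLM.contDiff).cexp, fun n => ⟨0, 1, fun x => ?_⟩⟩
  have h : ∀ n : ℕ, iteratedDeriv n (fun x : ℝ => cexp (I * x)) =
      fun x : ℝ => I ^ n * cexp (I * x) := by
    intro n
    induction n with
    | zero => simp
    | succ n ih =>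
      rw [iteratedDeriv_succ, ih]
      funext x
      have h1 : HasDerivAt (fun x : ℝ => I * (x : ℂ)) (I * 1) x :=
        (hasDerivAt_id x).ofReal_comp.const_mul I
      rw [(h1.cexp.const_mul (I ^ n)).deriv]
      ring
  rw [norm_iteratedFDeriv_eq_norm_iteratedDeriv, h n]
  simp [mul_comm I, norm_exp_ofReal_mul_I]

section Plancherel

variable {V : Type*} [NormedAddCommGroup V] [InnerProductSpace ℝ V] [FiniteDimensional ℝ V]
  [MeasurableSpace V] [BorelSpace V]

theorem continuous_fourier_of_integrable {f : V → ℂ} (hf : Integrable f) : Continuous (𝓕 f) :=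
  VectorFourier.fourierIntegral_continuous Real.continuous_fourierChar
    (L := innerₗ V) continuous_inner hf

theorem fourier_toLp_ae_eq {f : V → ℂ} (hf : Integrable f) (hf2 : MemLp f 2) :
    (𝓕 (hf2.toLp f) : Lp (α := V) ℂ 2) =ᵐ[volume] 𝓕 f := by
  refine ae_eq_of_integral_contDiff_smul_eq
    ((Lp.memLp _).locallyIntegrable (by norm_num))
    (continuous_fourier_of_integrable hf).locallyIntegrable fun g g_smooth g_cpt => ?_
  have hg₁ : HasCompactSupport (Complex.ofRealCLM ∘ g) := g_cpt.comp_left rfl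
  have hg₂ : ContDiff ℝ ∞ (Complex.ofRealCLM ∘ g) := by fun_prop
  set φ : 𝓢(V, ℂ) := hg₁.toSchwartzMap hg₂ with hφ
  have h1 := congrArg (fun T => T φ) (Lp.fourier_toTemperedDistribution_eq (hf2.toLp f))
  simp only [TemperedDistribution.fourier_apply, Lp.toTemperedDistribution_apply] at h1
  have hφi : Integrable φ volume := φ.integrable
  have h2 := VectorFourier.integral_fourierIntegral_smul_eq_flip (L := innerₗ V)
    Real.continuous_fourierChar continuous_inner hφi hf
  rw [flip_innerₗ] at h2
  calc _ = ∫ x, φ x • (𝓕 (hf2.toLp f) : Lp ℂ 2 (volume : Measure V)) x := by simp [hφ]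
    _ = ∫ x, (𝓕 φ) x • (hf2.toLp f) x := h1.symm
    _ = ∫ x, (𝓕 φ) x • f x := by
      refine integral_congr_ae ?_
      filter_upwards [hf2.coeFn_toLp] with x hx
      rw [hx]
    _ = ∫ x, φ x • 𝓕 f x := h2
    _ = _ := by simp [hφ]

/-- Plancherel's theorem for the Fourier integral on `L¹ ∩ L²`. -/
theorem eLpNorm_fourier_eq {f : V → ℂ} (hf : Integrable f) (hf2 : MemLp f 2) :
    eLpNorm (𝓕 f) 2 = eLpNorm f 2 := by
  rw [← eLpNorm_congr_ae (fourier_toLp_ae_eq hf hf2), ← Lp.enorm_def,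
    ← eLpNorm_congr_ae hf2.coeFn_toLp, ← Lp.enorm_def, enorm_eq_iff_norm_eq,
    Lp.norm_fourier_eq]

theorem eLpNorm_fourierInv_eq {f : V → ℂ} (hf : Integrable f) (hf2 : MemLp f 2) :
    eLpNorm (𝓕⁻ f) 2 = eLpNorm f 2 := by
  have h : (𝓕⁻ f : V → ℂ) = 𝓕 f ∘ Neg.neg := by
    funext x
    exact Real.fourierInv_eq_fourier_neg f x
  rw [h, eLpNorm_comp_measurePreserving
    (continuous_fourier_of_integrable hf).aestronglyMeasurable (Measure.measurePreserving_neg _),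
    eLpNorm_fourier_eq hf hf2]

theorem eLpNorm_comp_const_smul {h : V → ℂ} (hh : AEStronglyMeasurable h) {r : ℝ} (hr : r ≠ 0) :
    eLpNorm (fun x => h (r • x)) 2 =
      ENNReal.ofReal |(r ^ Module.finrank ℝ V)⁻¹| ^ (1 / 2 : ℝ) * eLpNorm h 2 := by
  have hm : Measurable (fun x : V => r • x) := measurable_const_smul r
  have hmap := Measure.map_addHaar_smul (volume : Measure V) hr
  have hac : AEStronglyMeasurable h (Measure.map (fun x : V => r • x) volume) := by
    rw [hmap]
    exact hh.smul_measure _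
  change eLpNorm (h ∘ fun x : V => r • x) 2 volume = _
  rw [← eLpNorm_map_measure hac hm.aemeasurable, hmap,
    eLpNorm_smul_measure_of_ne_top (by norm_num)]
  simp

end Plancherel

theorem memLp_weight_mul_schwartz {E : Type*} [NormedAddCommGroup E] [NormedSpace ℝ E]
    [MeasurableSpace E] [BorelSpace E] [SecondCountableTopology E] {μ : Measure E}
    [μ.HasTemperateGrowth] {w p : E → ℝ}
    (hw : Measurable w) (hp : p.HasTemperateGrowth) (hwp : ∀ x, |w x| ≤ |p x|)
    (f : 𝓢(E, ℂ)) (q : ℝ≥0∞) : MemLp (fun x => (w x : ℂ) * f x) q μ := by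
  refine ((smulLeftCLM ℂ p f).memLp q μ).mono
    ((Complex.measurable_ofReal.comp hw).aestronglyMeasurable.mul
      f.continuous.aestronglyMeasurable) (.of_forall fun x => ?_)
  rw [smulLeftCLM_apply_apply hp, norm_mul, norm_smul, Complex.norm_real]
  exact mul_le_mul_of_nonneg_right (hwp x) (norm_nonneg _)

theorem exists_nat_rpow_le_one_add_pow {s : ℝ} (hs : 0 ≤ s) :
    ∃ k : ℕ, ∀ a : ℝ, 0 ≤ a → a ^ s ≤ (1 + a) ^ k := by
  obtain ⟨k, hk⟩ := exists_nat_ge s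
  refine ⟨k, fun a ha => ?_⟩
  calc a ^ s ≤ (1 + a) ^ s := Real.rpow_le_rpow ha (by linarith) hs
    _ ≤ (1 + a) ^ (k : ℝ) := Real.rpow_le_rpow_of_exponent_le (by linarith) hk
    _ = (1 + a) ^ k := Real.rpow_natCast _ _

theorem FT1_eq_fourier (f : ℝ → ℂ) (ξ : ℝ) : FT1 f ξ = 𝓕 f ((2 * π)⁻¹ • ξ) := by
  rw [FT1, Real.fourier_real_eq_integral_exp_smul]
  congr 1 with x
  rw [smul_eq_mul, smul_eq_mul]
  congr 2
  have : (π : ℂ) ≠ 0 := by exact_mod_cast Real.pi_ne_zero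
  push_cast
  field_simp

theorem IFT1_eq_fourierInv (g : ℝ → ℂ) (x : ℝ) :
    IFT1 g x = (2 * (π : ℂ))⁻¹ * 𝓕⁻ g ((2 * π)⁻¹ • x) := by
  rw [IFT1, Real.fourierInv_eq']
  congr 2 with ξ
  rw [smul_eq_mul]
  congr 2
  have : (π : ℂ) ≠ 0 := by exact_mod_cast Real.pi_ne_zero
  simp only [RCLike.inner_apply, conj_trivial, smul_eq_mul]
  push_cast
  field_simp

theorem L2F_IFT1 {g : ℝ → ℂ} (hg : Integrable g) (hg2 : MemLp g 2) :
    L2F (IFT1 g) = ‖(2 * (π : ℂ))⁻¹‖ₑ * (ENNReal.ofReal (2 * π) ^ (1 / 2 : ℝ) * eLpNorm g 2) := by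
  have hc : Continuous (𝓕⁻ g) := by
    rw [Real.fourierInv_eq_fourier_comp_neg]
    exact continuous_fourier_of_integrable hg.comp_neg
  have h : IFT1 g = (2 * (π : ℂ))⁻¹ • fun x : ℝ => 𝓕⁻ g ((2 * π)⁻¹ • x) := by
    funext x
    exact IFT1_eq_fourierInv g x
  rw [L2F, h, eLpNorm_const_smul, eLpNorm_comp_const_smul hc.aestronglyMeasurable (by positivity),
    eLpNorm_fourierInv_eq hg hg2]
  simp [abs_of_pos Real.pi_pos]

theorem FT2_eq_fourier {f : ℝ × ℝ → ℂ} (hf : Integrable f) (ξ η : ℝ) :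
    FT2 (fun x y => f (x, y)) ξ η =
      𝓕 (f ∘ WithLp.ofLp : WithLp 2 (ℝ × ℝ) → ℂ) ((2 * π)⁻¹ • WithLp.toLp 2 (ξ, η)) := by
  have hint : Integrable (fun p : ℝ × ℝ => cexp (-I * ((ξ : ℂ) * p.1 + (η : ℂ) * p.2)) * f p) := by
    refine hf.norm.mono' (AEStronglyMeasurable.mul (by fun_prop) hf.1) (.of_forall fun p => ?_)
    have : -I * ((ξ : ℂ) * p.1 + (η : ℂ) * p.2) = ((-(ξ * p.1 + η * p.2) : ℝ) : ℂ) * I := by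
      push_cast; ring
    rw [norm_mul, this, norm_exp_ofReal_mul_I, one_mul]
  rw [FT2, ← integral_prod (fun p : ℝ × ℝ => cexp (-I * ((ξ : ℂ) * p.1 + (η : ℂ) * p.2)) * f p) hint,
    Real.fourier_eq', ← Measure.volume_eq_prod,
    ← (WithLp.volume_preserving_ofLp ℝ ℝ).integral_comp
      (MeasurableEquiv.toLp 2 (ℝ × ℝ)).symm.measurableEmbedding]
  congr 1 with p
  rw [smul_eq_mul, Function.comp_apply]
  congr 2
  have : (π : ℂ) ≠ 0 := by exact_mod_cast Real.pi_ne_zero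
  simp only [WithLp.prod_inner_apply, RCLike.inner_apply, conj_trivial, WithLp.ofLp_smul,
    Prod.smul_fst, Prod.smul_snd, smul_eq_mul]
  push_cast
  field_simp

theorem IFT2_eq_FT2_neg (g : ℝ → ℝ → ℂ) (x y : ℝ) :
    IFT2 g x y = ((2 * (π : ℂ)) ^ 2)⁻¹ * FT2 g (-x) (-y) := by
  rw [IFT2, FT2]
  congr 4 with ξ
  congr 1 with η
  congr 2
  push_cast
  ring

theorem L2K_IFT2 {g : ℝ × ℝ → ℂ} (hg : Integrable g) (hg2 : MemLp g 2) :
    L2K (IFT2 fun ξ η => g (ξ, η)) =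
      ‖((2 * (π : ℂ)) ^ 2)⁻¹‖ₑ *
        (ENNReal.ofReal ((2 * π) ^ 2) ^ (1 / 2 : ℝ) * eLpNorm g 2) := by
  have hpres := WithLp.volume_preserving_ofLp ℝ ℝ
  set G : WithLp 2 (ℝ × ℝ) → ℂ := g ∘ WithLp.ofLp with hG
  have hG1 : Integrable G := hpres.integrable_comp_of_integrable hg
  have hG2 : MemLp G 2 := hg2.comp_measurePreserving hpres
  have hc : Continuous (𝓕 G) := continuous_fourier_of_integrable hG1
  have hr : -(2 * π)⁻¹ ≠ 0 := neg_ne_zero.mpr (by positivity)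
  have h : (fun p : ℝ × ℝ => IFT2 (fun ξ η => g (ξ, η)) p.1 p.2) =
      ((2 * (π : ℂ)) ^ 2)⁻¹ • ((fun v => 𝓕 G ((-(2 * π)⁻¹) • v)) ∘ WithLp.toLp 2) := by
    funext p
    rw [IFT2_eq_FT2_neg, FT2_eq_fourier hg]
    simp only [Pi.smul_apply, smul_eq_mul, Function.comp_apply, hG]
    congr 1
    refine congrArg _ ?_
    refine WithLp.ofLp_injective 2 (Prod.ext ?_ ?_) <;> simp
  have hfin : Module.finrank ℝ (WithLp 2 (ℝ × ℝ)) = 2 := by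
    rw [(WithLp.linearEquiv 2 ℝ (ℝ × ℝ)).finrank_eq]; simp
  have hcs : Continuous fun v => 𝓕 G ((-(2 * π)⁻¹) • v) := hc.comp (continuous_const_smul _)
  rw [L2K, h, eLpNorm_const_smul,
    eLpNorm_comp_measurePreserving hcs.aestronglyMeasurable (WithLp.volume_preserving_toLp ℝ ℝ),
    eLpNorm_comp_const_smul hc.aestronglyMeasurable hr, eLpNorm_fourier_eq hG1 hG2, hfin, hG,
    eLpNorm_comp_measurePreserving hg.1 hpres, neg_sq, inv_pow, inv_inv,
    abs_of_pos (by positivity)]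

theorem exists_schwartz_FT2 (f : 𝓢(ℝ × ℝ, ℂ)) :
    ∃ G : 𝓢(ℝ × ℝ, ℂ), ∀ ξ η, FT2 (fun x y => f (x, y)) ξ η = G (ξ, η) := by
  let e := WithLp.prodContinuousLinearEquiv 2 ℝ ℝ ℝ
  let r : ℝˣ := Units.mk0 (2 * π)⁻¹ (by positivity)
  refine ⟨compCLMOfContinuousLinearEquiv ℂ
    (e.symm.trans (ContinuousLinearEquiv.smulLeft r))
    (𝓕 (compCLMOfContinuousLinearEquiv ℂ e f)), fun ξ η => ?_⟩
  rw [FT2_eq_fourier f.integrable]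
  rfl

theorem exists_schwartz_IFT2 (g : 𝓢(ℝ × ℝ, ℂ)) :
    ∃ F : 𝓢(ℝ × ℝ, ℂ), ∀ x y, IFT2 (fun ξ η => g (ξ, η)) x y = F (x, y) := by
  obtain ⟨F, hF⟩ := exists_schwartz_FT2 g
  refine ⟨((2 * (π : ℂ)) ^ 2)⁻¹ •
    compCLMOfContinuousLinearEquiv ℂ (ContinuousLinearEquiv.neg ℝ) F, fun x y => ?_⟩
  rw [IFT2_eq_FT2_neg, hF]
  rfl

theorem exists_schwartz_FT1 (f : 𝓢(ℝ, ℂ)) : ∃ G : 𝓢(ℝ, ℂ), ∀ ξ, FT1 f ξ = G ξ := by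
  let r : ℝˣ := Units.mk0 (2 * π)⁻¹ (by positivity)
  refine ⟨compCLMOfContinuousLinearEquiv ℂ (ContinuousLinearEquiv.smulLeft r) (𝓕 f), fun ξ => ?_⟩
  rw [FT1_eq_fourier]
  rfl

theorem rpow_weight_le {s : ℝ} (hs : 0 < s) {ζ : ℝ} (hζ : ζ ≠ 0) (ξ : ℝ) :
    (ξ ^ 2 + (ζ - ξ) ^ 2) ^ (-s) ≤ 4 ^ s * |ζ| ^ (-(2 * s)) * (1 + ‖ξ / ζ‖ ^ 2) ^ (-(2 * s) / 2) := by
  have hζ2 : 0 < ζ ^ 2 := by positivity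
  have hlow : ζ ^ 2 * (1 + (ξ / ζ) ^ 2) / 4 ≤ ξ ^ 2 + (ζ - ξ) ^ 2 := by
    have : ζ ^ 2 * (1 + (ξ / ζ) ^ 2) = ζ ^ 2 + ξ ^ 2 := by field_simp
    rw [this]
    nlinarith [sq_nonneg (7 * ξ - 4 * ζ), sq_nonneg ζ]
  have habs : |ζ| ^ (-(2 * s)) = (ζ ^ 2) ^ (-s) := by
    rw [← sq_abs ζ, ← Real.rpow_natCast, ← Real.rpow_mul (abs_nonneg ζ)]
    congr 1
    push_cast
    ring
  have h4 : (4 : ℝ) ^ s = (4⁻¹ : ℝ) ^ (-s) := by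
    rw [Real.inv_rpow (by norm_num), Real.rpow_neg (by norm_num), inv_inv]
  calc _ ≤ (ζ ^ 2 * (1 + (ξ / ζ) ^ 2) / 4) ^ (-s) :=
        Real.rpow_le_rpow_of_nonpos (by positivity) hlow (by linarith)
    _ = _ := by
      rw [habs, h4, Real.norm_eq_abs, sq_abs, ← Real.mul_rpow (by norm_num) (by positivity),
        show -(2 * s) / 2 = -s by ring, ← Real.mul_rpow (by positivity) (by positivity)]
      congr 1
      ring

/-- The weight `(ξ² + η²)^{-(1/2+ε)}` has integral at most `C |ζ|^{-2ε}` on the line `ξ + η = ζ`. -/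
theorem exists_lintegral_rpow_weight_le {ε : ℝ} (hε : 0 < ε) :
    ∃ C : ℝ, 0 < C ∧ ∀ ζ : ℝ, ζ ≠ 0 →
      ENNReal.ofReal (|ζ| ^ (2 * ε)) *
        ∫⁻ ξ : ℝ, ENNReal.ofReal ((ξ ^ 2 + (ζ - ξ) ^ 2) ^ (-(1 / 2 + ε))) ≤ ENNReal.ofReal C := by
  set s : ℝ := 1 / 2 + ε with hs
  have hs0 : 0 < s := by positivity
  set φ : ℝ → ℝ := fun u => (1 + ‖u‖ ^ 2) ^ (-(2 * s) / 2) with hφ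
  have hφi : Integrable φ := integrable_rpow_neg_one_add_norm_sq (by
    rw [Module.finrank_self, hs]; push_cast; linarith)
  have hφ0 : ∀ u, 0 ≤ φ u := fun u => by positivity
  have hI : 0 ≤ ∫ u, φ u := integral_nonneg hφ0
  refine ⟨4 ^ s * (∫ u, φ u) + 1, by positivity, fun ζ hζ => ?_⟩
  have hζ0 : 0 < |ζ| := abs_pos.mpr hζ
  have hle : ∫⁻ ξ : ℝ, ENNReal.ofReal ((ξ ^ 2 + (ζ - ξ) ^ 2) ^ (-s)) ≤
      ENNReal.ofReal (4 ^ s * |ζ| ^ (-(2 * s)) * (|ζ| * ∫ u, φ u)) := by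
    calc _ ≤ ∫⁻ ξ : ℝ, ENNReal.ofReal (4 ^ s * |ζ| ^ (-(2 * s)) * φ (ξ / ζ)) :=
          lintegral_mono fun ξ => ENNReal.ofReal_le_ofReal (rpow_weight_le hs0 hζ ξ)
      _ = ENNReal.ofReal (∫ ξ : ℝ, 4 ^ s * |ζ| ^ (-(2 * s)) * φ (ξ / ζ)) :=
          (ofReal_integral_eq_lintegral_ofReal ((hφi.comp_div hζ).const_mul _)
            (.of_forall fun ξ => mul_nonneg (by positivity) (hφ0 _))).symm
      _ = _ := by rw [integral_const_mul, Measure.integral_comp_div, smul_eq_mul]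
  refine (mul_le_mul_right hle _).trans ?_
  rw [← ENNReal.ofReal_mul (by positivity)]
  refine ENNReal.ofReal_le_ofReal ?_
  have hpow : |ζ| ^ (2 * ε) * (|ζ| ^ (-(2 * s)) * |ζ|) = 1 := by
    nth_rewrite 3 [← Real.rpow_one |ζ|]
    rw [← Real.rpow_add hζ0, ← Real.rpow_add hζ0, hs,
      show 2 * ε + (-(2 * (1 / 2 + ε)) + 1) = 0 by ring, Real.rpow_zero]
  calc _ = (|ζ| ^ (2 * ε) * (|ζ| ^ (-(2 * s)) * |ζ|)) * (4 ^ s * ∫ u, φ u) := by ring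
    _ ≤ _ := by rw [hpow]; linarith

theorem lintegral_mul_sq_le {α : Type*} [MeasurableSpace α] (μ : Measure α) {f g : α → ℝ≥0∞}
    (hf : AEMeasurable f μ) (hg : AEMeasurable g μ) :
    (∫⁻ a, f a * g a ∂μ) ^ 2 ≤ (∫⁻ a, f a ^ 2 ∂μ) * ∫⁻ a, g a ^ 2 ∂μ := by
  have h := ENNReal.lintegral_mul_le_Lp_mul_Lq μ Real.HolderConjugate.two_two hf hg
  simp only [Pi.mul_apply, ENNReal.rpow_two] at h
  refine (pow_le_pow_left' h 2).trans_eq ?_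
  rw [mul_pow, ← ENNReal.rpow_two, ← ENNReal.rpow_two, ← ENNReal.rpow_mul, ← ENNReal.rpow_mul]
  norm_num

theorem eLpNorm_two_sq {α : Type*} [MeasurableSpace α] (μ : Measure α) (f : α → ℂ) :
    eLpNorm f 2 μ ^ 2 = ∫⁻ x, ‖f x‖ₑ ^ 2 ∂μ := by
  have h := eLpNorm_nnreal_pow_eq_lintegral (μ := μ) (f := f) (p := 2) (by norm_num)
  simpa using h

/-- Weighted `L²` bound for the integrals of a function over the lines `ξ + η = ζ`. -/
theorem exists_eLpNorm_integral_line_le {ε : ℝ} (hε : 0 < ε) :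
    ∃ C : ℝ, 0 < C ∧ ∀ f : ℝ × ℝ → ℂ, Continuous f →
      eLpNorm (fun ζ : ℝ => ((|ζ| ^ ε : ℝ) : ℂ) * ∫ ξ, f (ξ, ζ - ξ)) 2 ≤ ENNReal.ofReal C *
        eLpNorm (fun p : ℝ × ℝ =>
          (((p.1 ^ 2 + p.2 ^ 2) ^ ((1 / 2 + ε) / 2) : ℝ) : ℂ) * f p) 2 := by
  obtain ⟨C, hC, hCw⟩ := exists_lintegral_rpow_weight_le hε
  refine ⟨√C, Real.sqrt_pos.mpr hC, fun f hf => ?_⟩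
  set s : ℝ := 1 / 2 + ε with hs
  set F : ℝ × ℝ → ℂ := fun p => (((p.1 ^ 2 + p.2 ^ 2) ^ (s / 2) : ℝ) : ℂ) * f p with hF
  have hFm : Measurable F := by fun_prop
  have hpoint : ∀ ζ : ℝ, ζ ≠ 0 →
      ‖((|ζ| ^ ε : ℝ) : ℂ) * ∫ ξ, f (ξ, ζ - ξ)‖ₑ ^ 2 ≤
        ENNReal.ofReal C * ∫⁻ ξ, ‖F (ξ, ζ - ξ)‖ₑ ^ 2 := by
    intro ζ hζ
    have hpos : ∀ ξ : ℝ, 0 < ξ ^ 2 + (ζ - ξ) ^ 2 := by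
      intro ξ
      have : 0 < ζ ^ 2 := by positivity
      nlinarith [sq_nonneg (2 * ξ - ζ)]
    have hsplit : ∀ ξ : ℝ, ‖f (ξ, ζ - ξ)‖ₑ =
        ENNReal.ofReal ((ξ ^ 2 + (ζ - ξ) ^ 2) ^ (-(s / 2))) * ‖F (ξ, ζ - ξ)‖ₑ := by
      intro ξ
      simp only [hF]
      rw [enorm_mul, ← mul_assoc, ← ofReal_norm (((_ : ℝ) : ℂ)), Complex.norm_real,
        Real.norm_of_nonneg (by have := hpos ξ; positivity),
        ← ENNReal.ofReal_mul (by have := hpos ξ; positivity), ← Real.rpow_add (hpos ξ)]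
      simp
    have hCS : ‖∫ ξ, f (ξ, ζ - ξ)‖ₑ ^ 2 ≤
        (∫⁻ ξ : ℝ, ENNReal.ofReal ((ξ ^ 2 + (ζ - ξ) ^ 2) ^ (-s))) *
          ∫⁻ ξ, ‖F (ξ, ζ - ξ)‖ₑ ^ 2 := by
      calc _ ≤ (∫⁻ ξ, ‖f (ξ, ζ - ξ)‖ₑ) ^ 2 :=
            pow_le_pow_left' (enorm_integral_le_lintegral_enorm _) 2
        _ = (∫⁻ ξ, ENNReal.ofReal ((ξ ^ 2 + (ζ - ξ) ^ 2) ^ (-(s / 2))) *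
              ‖F (ξ, ζ - ξ)‖ₑ) ^ 2 := by simp_rw [hsplit]
        _ ≤ (∫⁻ ξ, ENNReal.ofReal ((ξ ^ 2 + (ζ - ξ) ^ 2) ^ (-(s / 2))) ^ 2) *
              ∫⁻ ξ, ‖F (ξ, ζ - ξ)‖ₑ ^ 2 :=
            lintegral_mul_sq_le _ (by fun_prop) (by fun_prop)
        _ = _ := by
          congr 1
          refine lintegral_congr fun ξ => ?_
          have := hpos ξ
          rw [← ENNReal.ofReal_pow (by positivity), ← Real.rpow_natCast, ← Real.rpow_mul this.le]
          congr 2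
          push_cast
          ring
    have habs : ‖((|ζ| ^ ε : ℝ) : ℂ)‖ₑ ^ 2 = ENNReal.ofReal (|ζ| ^ (2 * ε)) := by
      rw [← ofReal_norm, Complex.norm_real, Real.norm_of_nonneg (by positivity),
        ← ENNReal.ofReal_pow (by positivity), ← Real.rpow_natCast, ← Real.rpow_mul (abs_nonneg ζ)]
      congr 2
      push_cast
      ring
    calc _ = ENNReal.ofReal (|ζ| ^ (2 * ε)) * ‖∫ ξ, f (ξ, ζ - ξ)‖ₑ ^ 2 := by
          rw [enorm_mul, mul_pow, habs]
      _ ≤ ENNReal.ofReal (|ζ| ^ (2 * ε)) *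
          ((∫⁻ ξ : ℝ, ENNReal.ofReal ((ξ ^ 2 + (ζ - ξ) ^ 2) ^ (-s))) *
            ∫⁻ ξ, ‖F (ξ, ζ - ξ)‖ₑ ^ 2) := by gcongr
      _ ≤ _ := by
        rw [← mul_assoc]
        gcongr
        exact hCw ζ hζ
  have hmain : ∫⁻ ζ : ℝ, ‖((|ζ| ^ ε : ℝ) : ℂ) * ∫ ξ, f (ξ, ζ - ξ)‖ₑ ^ 2 ≤
      ENNReal.ofReal C * ∫⁻ p, ‖F p‖ₑ ^ 2 := by
    calc _ ≤ ∫⁻ ζ : ℝ, ENNReal.ofReal C * ∫⁻ ξ, ‖F (ξ, ζ - ξ)‖ₑ ^ 2 := by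
          refine lintegral_mono_ae ?_
          filter_upwards [Measure.ae_ne volume (0 : ℝ)] with ζ hζ using hpoint ζ hζ
      _ = ENNReal.ofReal C * ∫⁻ ζ : ℝ, ∫⁻ ξ, ‖F (ξ, ζ - ξ)‖ₑ ^ 2 :=
          lintegral_const_mul' _ _ ENNReal.ofReal_ne_top
      _ = ENNReal.ofReal C * ∫⁻ ξ : ℝ, ∫⁻ ζ, ‖F (ξ, ζ - ξ)‖ₑ ^ 2 := by
          rw [lintegral_lintegral_swap]
          exact Measurable.aemeasurable (by fun_prop)
      _ = ENNReal.ofReal C * ∫⁻ ξ : ℝ, ∫⁻ η, ‖F (ξ, η)‖ₑ ^ 2 := by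
          congr 2 with ξ
          exact lintegral_sub_right_eq_self (fun η => ‖F (ξ, η)‖ₑ ^ 2) ξ
      _ = _ := by
          rw [Measure.volume_eq_prod, lintegral_prod _ (by fun_prop)]
  rw [← eLpNorm_two_sq, ← eLpNorm_two_sq] at hmain
  rw [← ENNReal.pow_le_pow_left_iff two_ne_zero, mul_pow,
    ← ENNReal.ofReal_pow (Real.sqrt_nonneg C), Real.sq_sqrt hC.le]
  exact hmain

theorem continuous_integral_snd (f : 𝓢(ℝ × ℝ, ℂ)) :
    Continuous fun x : ℝ => ∫ y : ℝ, f (x, y) := by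
  have hp : Function.HasTemperateGrowth fun p : ℝ × ℝ => 1 + p.2 ^ 2 := by
    have : Function.HasTemperateGrowth fun p : ℝ × ℝ => p.2 :=
      (ContinuousLinearMap.snd ℝ ℝ ℝ).hasTemperateGrowth
    fun_prop
  set g : 𝓢(ℝ × ℝ, ℂ) := smulLeftCLM ℂ (fun p : ℝ × ℝ => 1 + p.2 ^ 2) f with hg
  obtain ⟨C, hC⟩ := g.decay 0 0
  refine continuous_of_dominated (bound := fun y => C * (1 + y ^ 2)⁻¹)
    (fun x => (f.continuous.comp (by fun_prop)).aestronglyMeasurable)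
    (fun x => .of_forall fun y => ?_) (integrable_inv_one_add_sq.const_mul C)
    (.of_forall fun y => f.continuous.comp (by fun_prop))
  have h := hC.2 (x, y)
  simp only [pow_zero, one_mul, norm_iteratedFDeriv_zero, hg, smulLeftCLM_apply_apply hp,
    norm_smul] at h
  rw [Real.norm_of_nonneg (by positivity)] at h
  rw [← div_eq_mul_inv, le_div_iff₀ (by positivity), mul_comm]
  exact h

/-- The continuous linear equivalence `(ζ, ξ) ↦ (ξ, ζ - ξ)`. -/
def lineShear : (ℝ × ℝ) ≃L[ℝ] ℝ × ℝ :=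
  ContinuousLinearEquiv.equivOfInverse
    ((ContinuousLinearMap.snd ℝ ℝ ℝ).prod
      (ContinuousLinearMap.fst ℝ ℝ ℝ - ContinuousLinearMap.snd ℝ ℝ ℝ))
    ((ContinuousLinearMap.fst ℝ ℝ ℝ + ContinuousLinearMap.snd ℝ ℝ ℝ).prod
      (ContinuousLinearMap.fst ℝ ℝ ℝ))
    (fun p => by ext <;> simp) (fun p => by ext <;> simp)

theorem IFT2_diag (k : 𝓢(ℝ × ℝ, ℂ)) (a : ℝ) :
    IFT2 (fun ξ η => k (ξ, η)) a a =
      (2 * (π : ℂ))⁻¹ * IFT1 (fun ζ => ∫ ξ, k (ξ, ζ - ξ)) a := by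
  set k' : 𝓢(ℝ × ℝ, ℂ) := compCLMOfContinuousLinearEquiv ℂ lineShear k with hk'
  have hint : Integrable (fun p : ℝ × ℝ => cexp (I * ((p.1 : ℂ) * a)) * k' p)
      (volume.prod volume) := by
    rw [← Measure.volume_eq_prod]
    refine k'.integrable.norm.mono' (AEStronglyMeasurable.mul (by fun_prop)
      k'.continuous.aestronglyMeasurable) (.of_forall fun p => ?_)
    have : I * ((p.1 : ℂ) * a) = ((p.1 * a : ℝ) : ℂ) * I := by push_cast; ring
    rw [norm_mul, this, norm_exp_ofReal_mul_I, one_mul]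
  have hswap : ∫ ξ : ℝ, ∫ ζ : ℝ, cexp (I * ((ζ : ℂ) * a)) * k' (ζ, ξ) =
      ∫ ζ : ℝ, ∫ ξ : ℝ, cexp (I * ((ζ : ℂ) * a)) * k' (ζ, ξ) :=
    integral_integral_swap (f := fun ξ ζ : ℝ => cexp (I * ((ζ : ℂ) * a)) * k' (ζ, ξ)) hint.swap
  have hshift : ∀ ξ : ℝ, ∫ η : ℝ, cexp (I * ((ξ : ℂ) * a + (η : ℂ) * a)) * k (ξ, η) =
      ∫ ζ : ℝ, cexp (I * ((ζ : ℂ) * a)) * k' (ζ, ξ) := by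
    intro ξ
    rw [← integral_sub_right_eq_self _ ξ]
    congr 1 with ζ
    congr 2
    push_cast
    ring
  rw [IFT2, IFT1, ← mul_assoc]
  simp_rw [hshift]
  rw [hswap]
  congr 1
  · rw [sq, mul_inv]
  · congr 1 with ζ
    rw [integral_const_mul, mul_assoc]
    rfl

theorem exists_schwartz_diag (F : 𝓢(ℝ × ℝ, ℂ)) : ∃ ρ : 𝓢(ℝ, ℂ), ∀ a, F (a, a) = ρ a := by
  have hg : Function.HasTemperateGrowth fun a : ℝ => (a, a) :=
    ((ContinuousLinearMap.id ℝ ℝ).prod (ContinuousLinearMap.id ℝ ℝ)).hasTemperateGrowth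
  refine ⟨compCLM ℂ hg ⟨1, 1, fun a => ?_⟩ F, fun a => rfl⟩
  simp [Prod.norm_def]

/-- Restriction to the diagonal is integration over the lines `ξ + η = ζ` on the Fourier side. -/
theorem FT1_IFT2_diag (k : 𝓢(ℝ × ℝ, ℂ)) (ζ : ℝ) :
    FT1 (fun a => IFT2 (fun ξ η => k (ξ, η)) a a) ζ =
      (2 * (π : ℂ))⁻¹ * ∫ ξ, k (ξ, ζ - ξ) := by
  obtain ⟨F, hF⟩ := exists_schwartz_IFT2 k
  obtain ⟨ρ, hρ⟩ := exists_schwartz_diag F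
  set k' : 𝓢(ℝ × ℝ, ℂ) := compCLMOfContinuousLinearEquiv ℂ lineShear k with hk'
  set H : ℝ → ℂ := fun ζ => ∫ ξ, k (ξ, ζ - ξ) with hH
  have hHc : Continuous H := continuous_integral_snd k'
  have hHi : Integrable H := by
    have h : Integrable k' (volume.prod volume) := by
      rw [← Measure.volume_eq_prod]
      exact k'.integrable
    exact h.integral_prod_left
  have hπ : (2 * (π : ℂ)) ≠ 0 := by
    exact_mod_cast (by positivity : 2 * π ≠ 0)
  have hπ' : (2 * π) ≠ 0 := by positivity
  have hval : ∀ a, ρ a = ((2 * (π : ℂ)) ^ 2)⁻¹ * 𝓕⁻ H ((2 * π)⁻¹ • a) := by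
    intro a
    rw [← hρ, ← hF, IFT2_diag, IFT1_eq_fourierInv, ← mul_assoc, sq, mul_inv (2 * (π : ℂ)) (2 * (π : ℂ))]
  have hinv : ∀ b, 𝓕⁻ H b = (2 * (π : ℂ)) ^ 2 * ρ (b * (2 * π)) := by
    intro b
    rw [hval, ← mul_assoc, mul_inv_cancel₀ (pow_ne_zero 2 hπ), one_mul, smul_eq_mul, mul_comm b,
      inv_mul_cancel_left₀ hπ']
  have hinvi : Integrable (𝓕⁻ H) := by
    have h : Integrable fun b => (2 * (π : ℂ)) ^ 2 * ρ (b * (2 * π)) :=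
      ((ρ.integrable : Integrable ρ volume).comp_mul_right' hπ').const_mul _
    exact h.congr (.of_forall fun b => (hinv b).symm)
  have hfi : Integrable (𝓕 H) := by
    refine hinvi.comp_neg.congr (.of_forall fun b => ?_)
    simp [Real.fourierInv_eq_fourier_neg]
  have hHH : 𝓕 (𝓕⁻ H) = H := hHc.fourier_fourierInv_eq hHi hfi
  change _ = _ * H ζ
  rw [← hHH, FT1, Real.fourier_real_eq_integral_exp_smul]
  have hscale := Measure.integral_comp_mul_right
    (fun a : ℝ => cexp (-I * (ζ : ℂ) * (a : ℂ)) * ρ a) (2 * π)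
  have hcongr : ∀ b : ℝ, cexp (((-2 * π * b * ζ : ℝ) : ℂ) * I) • 𝓕⁻ H b =
      (2 * (π : ℂ)) ^ 2 *
        (cexp (-I * (ζ : ℂ) * ((b * (2 * π) : ℝ) : ℂ)) * ρ (b * (2 * π))) := by
    intro b
    rw [hinv, smul_eq_mul, mul_left_comm]
    congr 3
    push_cast
    ring
  simp_rw [hcongr, integral_const_mul, hscale, hF, hρ]
  rw [abs_of_pos (by positivity), Complex.real_smul]
  push_cast
  field_simp

theorem exists_schwartz_freeGamma_symbol (G : 𝓢(ℝ × ℝ, ℂ)) (t : ℝ) :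
    ∃ k : 𝓢(ℝ × ℝ, ℂ), ∀ p : ℝ × ℝ,
      k p = cexp (I * (t : ℂ) * ((p.2 : ℂ) ^ 2 - (p.1 : ℂ) ^ 2)) * G p := by
  have h1 : Function.HasTemperateGrowth fun p : ℝ × ℝ => p.1 :=
    (ContinuousLinearMap.fst ℝ ℝ ℝ).hasTemperateGrowth
  have h2 : Function.HasTemperateGrowth fun p : ℝ × ℝ => p.2 :=
    (ContinuousLinearMap.snd ℝ ℝ ℝ).hasTemperateGrowth
  have h3 : Function.HasTemperateGrowth fun p : ℝ × ℝ => t * (p.2 ^ 2 - p.1 ^ 2) := by fun_prop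
  have h4 := hasTemperateGrowth_cexp_I_mul.comp h3
  refine ⟨smulLeftCLM ℂ ((fun x : ℝ => cexp (I * x)) ∘
    fun p : ℝ × ℝ => t * (p.2 ^ 2 - p.1 ^ 2)) G, fun p => ?_⟩
  rw [smulLeftCLM_apply_apply h4, smul_eq_mul, Function.comp_apply]
  congr 2
  push_cast
  ring

theorem memLp_abs_rpow_mul {s : ℝ} (hs : 0 ≤ s) (f : 𝓢(ℝ, ℂ)) (q : ℝ≥0∞) :
    MemLp (fun ξ : ℝ => ((|ξ| ^ s : ℝ) : ℂ) * f ξ) q := by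
  obtain ⟨k, hk⟩ := exists_nat_rpow_le_one_add_pow (by positivity : 0 ≤ s / 2)
  have hp : Function.HasTemperateGrowth fun ξ : ℝ => (1 + ξ ^ 2) ^ k := by fun_prop
  refine memLp_weight_mul_schwartz (by fun_prop) hp (fun ξ => ?_) f q
  have h : |ξ| ^ s = (ξ ^ 2) ^ (s / 2) := by
    rw [← sq_abs, ← Real.rpow_natCast, ← Real.rpow_mul (abs_nonneg ξ)]
    congr 1
    push_cast
    ring
  rw [h, abs_of_nonneg (by positivity), abs_of_nonneg (by positivity)]
  exact hk _ (by positivity)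

theorem memLp_sq_add_sq_rpow_mul {s : ℝ} (hs : 0 ≤ s) (f : 𝓢(ℝ × ℝ, ℂ)) (q : ℝ≥0∞) :
    MemLp (fun p : ℝ × ℝ => (((p.1 ^ 2 + p.2 ^ 2) ^ s : ℝ) : ℂ) * f p) q := by
  obtain ⟨k, hk⟩ := exists_nat_rpow_le_one_add_pow hs
  have h1 : Function.HasTemperateGrowth fun p : ℝ × ℝ => p.1 :=
    (ContinuousLinearMap.fst ℝ ℝ ℝ).hasTemperateGrowth
  have h2 : Function.HasTemperateGrowth fun p : ℝ × ℝ => p.2 :=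
    (ContinuousLinearMap.snd ℝ ℝ ℝ).hasTemperateGrowth
  have hp : Function.HasTemperateGrowth fun p : ℝ × ℝ => (1 + (p.1 ^ 2 + p.2 ^ 2)) ^ k := by
    fun_prop
  refine memLp_weight_mul_schwartz (by fun_prop) hp (fun p => ?_) f q
  rw [abs_of_nonneg (by positivity), abs_of_nonneg (by positivity)]
  exact hk _ (by positivity)

theorem exists_L2F_absDx_IFT2_diag_le {ε : ℝ} (hε : 0 < ε) :
    ∃ C : ℝ, 0 < C ∧ ∀ k : 𝓢(ℝ × ℝ, ℂ),
      L2F (absDx ε fun a => IFT2 (fun ξ η => k (ξ, η)) a a) ≤ ENNReal.ofReal C *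
        eLpNorm (fun p : ℝ × ℝ =>
          (((p.1 ^ 2 + p.2 ^ 2) ^ ((1 / 2 + ε) / 2) : ℝ) : ℂ) * k p) 2 := by
  obtain ⟨C, hC, hCk⟩ := exists_eLpNorm_integral_line_le hε
  refine ⟨(2 * π)⁻¹ * (2 * π) ^ (1 / 2 : ℝ) * (2 * π)⁻¹ * C, by positivity, fun k => ?_⟩
  obtain ⟨F, hF⟩ := exists_schwartz_IFT2 k
  obtain ⟨ρ, hρ⟩ := exists_schwartz_diag F
  obtain ⟨R, hR⟩ := exists_schwartz_FT1 ρ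
  have hρF : (fun a => IFT2 (fun ξ η => k (ξ, η)) a a) = ρ := by
    funext a
    rw [hF, hρ]
  set g : ℝ → ℂ := fun ζ => ((|ζ| ^ ε : ℝ) : ℂ) * R ζ with hg
  have hgH : g = (2 * (π : ℂ))⁻¹ •
      fun ζ : ℝ => ((|ζ| ^ ε : ℝ) : ℂ) * ∫ ξ, k (ξ, ζ - ξ) := by
    funext ζ
    rw [hg, Pi.smul_apply, smul_eq_mul, mul_left_comm, ← FT1_IFT2_diag, hρF, hR]
  have habs : (absDx ε fun a => IFT2 (fun ξ η => k (ξ, η)) a a) = IFT1 g := by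
    funext x
    rw [hρF, absDx]
    simp_rw [hR, hg]
  have hc : ‖(2 * (π : ℂ))⁻¹‖ₑ = ENNReal.ofReal (2 * π)⁻¹ := by
    rw [← ofReal_norm, norm_inv, norm_mul, Complex.norm_real, Complex.norm_two,
      Real.norm_of_nonneg Real.pi_pos.le]
  have hg₁ : Integrable g := memLp_one_iff_integrable.mp (memLp_abs_rpow_mul hε.le R 1)
  have hg₂ : MemLp g 2 := memLp_abs_rpow_mul hε.le R 2
  rw [habs, L2F_IFT1 hg₁ hg₂, hgH, eLpNorm_const_smul, hc,
    ENNReal.ofReal_rpow_of_pos (by positivity)]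
  rw [ENNReal.ofReal_mul (by positivity), ENNReal.ofReal_mul (by positivity),
    ENNReal.ofReal_mul (by positivity)]
  simp only [mul_assoc]
  gcongr
  exact hCk k k.continuous

/-- Trace-type estimate for the free von-Neumann Schrödinger flow. -/
theorem trace_type_estimate_free_vonNeumann (ε : ℝ) (hε : 0 < ε) :
    ∃ C : ℝ, 0 < C ∧ ∀ Γ₀ : 𝓢(ℝ × ℝ, ℂ),
      (⨆ t : ℝ, L2F (fun x =>
          absDx ε (fun a => freeGamma (fun a b => Γ₀ (a, b)) t a a) x))
        ≤ ENNReal.ofReal C * L2K (absDxy (1/2 + ε) (fun a b => Γ₀ (a, b))) := by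
  obtain ⟨C, hC, hCk⟩ := exists_L2F_absDx_IFT2_diag_le hε
  refine ⟨C * (2 * π), by positivity, fun Γ₀ => iSup_le fun t => ?_⟩
  obtain ⟨G, hG⟩ := exists_schwartz_FT2 Γ₀
  obtain ⟨k, hk⟩ := exists_schwartz_freeGamma_symbol G t
  have hs : 0 ≤ (1 / 2 + ε) / 2 := by positivity
  set W : ℝ × ℝ → ℂ := fun p => (((p.1 ^ 2 + p.2 ^ 2) ^ ((1 / 2 + ε) / 2) : ℝ) : ℂ) * G p with hW
  have hfree : (fun a => freeGamma (fun a b => Γ₀ (a, b)) t a a) =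
      fun a => IFT2 (fun ξ η => k (ξ, η)) a a := by
    funext a
    simp_rw [freeGamma, hG, hk]
  have hnorm : eLpNorm (fun p : ℝ × ℝ =>
      (((p.1 ^ 2 + p.2 ^ 2) ^ ((1 / 2 + ε) / 2) : ℝ) : ℂ) * k p) 2 = eLpNorm W 2 := by
    refine eLpNorm_congr_norm_ae (.of_forall fun p => ?_)
    have h : I * (t : ℂ) * ((p.2 : ℂ) ^ 2 - (p.1 : ℂ) ^ 2) =
        ((t * (p.2 ^ 2 - p.1 ^ 2) : ℝ) : ℂ) * I := by push_cast; ring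
    rw [hk, h, norm_mul, norm_mul, norm_exp_ofReal_mul_I, one_mul, ← norm_mul]
  have hdata : L2K (absDxy (1 / 2 + ε) fun a b => Γ₀ (a, b)) =
      ENNReal.ofReal (2 * π)⁻¹ * eLpNorm W 2 := by
    have habs : (absDxy (1 / 2 + ε) fun a b => Γ₀ (a, b)) = IFT2 fun ξ η => W (ξ, η) := by
      funext x y
      simp_rw [absDxy, hG, hW]
    rw [habs, L2K_IFT2 (memLp_one_iff_integrable.mp (memLp_sq_add_sq_rpow_mul hs G 1))
      (memLp_sq_add_sq_rpow_mul hs G 2), ← mul_assoc, ENNReal.ofReal_rpow_of_pos (by positivity),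
      ← Real.sqrt_eq_rpow, Real.sqrt_sq (by positivity), ← ofReal_norm,
      ← ENNReal.ofReal_mul (norm_nonneg _), norm_inv, norm_pow, norm_mul, Complex.norm_real,
      Complex.norm_two, Real.norm_of_nonneg Real.pi_pos.le]
    congr 2
    field_simp
  rw [hfree, hdata, ← mul_assoc, ← ENNReal.ofReal_mul (by positivity), mul_assoc C,
    mul_inv_cancel₀ (by positivity), mul_one, ← hnorm]
  exact hCk k

end
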